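/- Let n ≥ 1 be an integer, l ∈ ℝ, and let ρ : ℝ → [0,∞) and f : (0,∞) → [0,∞) be measurable. For every x ∈ ℝ, s > 0 and d ∈ ℝ, the following identity of integrals of nonnegative functions holds (with both sides possibly infinite): ∫₀^∞∫₀^∞ ρ((d-μ)/σ) · s^{n-1} σ^{-(n+l+2)} f(((x-μ)²+s²)/σ²) dμ dσ = s^{-l-1} ∫₀^∞∫_{-∞}^{v·x/s} ρ(u + ((d-x)/s)·v) v^{n+l-1} f(u²+v²) du dv. Consequently, d minimizes the left-hand side (the posterior expected loss under the prior σ^{-(l+1)} 1_{μ≥0}) if and only if h = (d-x)/s minimizes h ↦ ∫₀^∞∫_{-∞}^{vy} ρ(u+hv) v^{n+l-1} f(u²+v²) du dv with y = x/s; hence the generalized Bayes estimator has the form δ_{π_l}(x,s) = x + s·φ(x/s) for a function φ of y = x/s alone. -/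

import Mathlib

open MeasureTheory Set
open scoped ENNReal

/-- Posterior expected loss (up to the normalizing constant) of the decision `d` at the
observation `(x,s)` under the prior `π_l(μ,σ) = σ^{-(l+1)} 1_{μ≥0}`. -/
noncomputable def postLoss (n : ℕ) (l : ℝ) (ρ f : ℝ → ℝ) (x s d : ℝ) : ℝ≥0∞ :=
  ∫⁻ σ in Ioi (0 : ℝ), ∫⁻ μ in Ioi (0 : ℝ),
    ENNReal.ofReal (ρ ((d - μ) / σ) *
      (s ^ ((n : ℝ) - 1) * σ ^ (-((n : ℝ) + l + 2)) * f (((x - μ) ^ 2 + s ^ 2) / σ ^ 2)))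

/-- The reduced objective: `h ↦ ∫₀^∞ ∫_{-∞}^{vy} ρ(u + hv) v^{n+l-1} f(u²+v²) du dv`. -/
noncomputable def bayesObj (n : ℕ) (l : ℝ) (ρ f : ℝ → ℝ) (y h : ℝ) : ℝ≥0∞ :=
  ∫⁻ v in Ioi (0 : ℝ), ∫⁻ u in Iio (v * y),
    ENNReal.ofReal (ρ (u + h * v) * (v ^ ((n : ℝ) + l - 1) * f (u ^ 2 + v ^ 2)))

/-- The affine substitution `μ = x - σ u` on the half-line `μ > 0`. -/
theorem lintegral_Ioi_zero_eq_lintegral_Iio_sub_mul (g : ℝ → ℝ≥0∞) (x : ℝ) {σ : ℝ} (hσ : 0 < σ) :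
    ∫⁻ μ in Ioi (0 : ℝ), g μ = ∫⁻ u in Iio (x / σ), ENNReal.ofReal σ * g (x - σ * u) := by
  have himg : (fun u : ℝ => x - σ * u) '' Iio (x / σ) = Ioi 0 := by
    ext μ
    simp only [mem_image, mem_Iio, mem_Ioi]
    constructor
    · rintro ⟨u, hu, rfl⟩
      rw [lt_div_iff₀ hσ] at hu
      linarith
    · intro hμ
      refine ⟨(x - μ) / σ, ?_, ?_⟩
      · gcongr
        linarith
      · field_simp
        ring
  have hderiv : ∀ u ∈ Iio (x / σ),
      HasDerivWithinAt (fun u : ℝ => x - σ * u) (-σ) (Iio (x / σ)) u := fun u _ => by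
    simpa using (((hasDerivAt_id u).const_mul σ).const_sub x).hasDerivWithinAt
  have hinj : InjOn (fun u : ℝ => x - σ * u) (Iio (x / σ)) := fun a _ b _ hab =>
    mul_left_cancel₀ hσ.ne' (sub_right_injective hab)
  rw [← himg, lintegral_image_eq_lintegral_abs_deriv_mul measurableSet_Iio hderiv hinj]
  simp only [abs_neg, abs_of_pos hσ]

/-- The inversion `σ = s / v` on the half-line `σ > 0`. -/
theorem lintegral_Ioi_zero_eq_lintegral_div (g : ℝ → ℝ≥0∞) {s : ℝ} (hs : 0 < s) :
    ∫⁻ σ in Ioi (0 : ℝ), g σ =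
      ∫⁻ v in Ioi (0 : ℝ), ENNReal.ofReal (s / v ^ 2) * g (s / v) := by
  have himg : (fun v : ℝ => s / v) '' Ioi 0 = Ioi 0 := by
    ext σ
    simp only [mem_image, mem_Ioi]
    constructor
    · rintro ⟨v, hv, rfl⟩
      positivity
    · intro hσ
      exact ⟨s / σ, by positivity, by field_simp⟩
  have hderiv : ∀ v ∈ Ioi (0 : ℝ),
      HasDerivWithinAt (fun v : ℝ => s / v) (-(s / v ^ 2)) (Ioi 0) v := fun v hv => by
    have h := ((hasDerivAt_inv (ne_of_gt hv)).const_mul s).hasDerivWithinAt (s := Ioi (0 : ℝ))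
    simpa [div_eq_mul_inv] using h
  have hinj : InjOn (fun v : ℝ => s / v) (Ioi 0) := fun a ha b hb hab => by
    have ha' : a ≠ 0 := ne_of_gt ha
    have hb' : b ≠ 0 := ne_of_gt hb
    rw [div_eq_div_iff ha' hb'] at hab
    exact (mul_left_cancel₀ hs.ne' hab).symm
  conv_lhs => rw [← himg, lintegral_image_eq_lintegral_abs_deriv_mul measurableSet_Ioi hderiv hinj]
  refine setLIntegral_congr_fun measurableSet_Ioi fun v _ => ?_
  have h : 0 ≤ s / v ^ 2 := by positivity
  simp only [abs_neg, abs_of_nonneg h]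

/-- The powers of `s` and `v` produced by the Jacobian of `(u, v) ↦ (x - s u / v, s / v)`. -/
theorem jacobian_mul_rpow (n : ℕ) (l : ℝ) {s v : ℝ} (hs : 0 < s) (hv : 0 < v) :
    s / v ^ 2 * (s / v) * (s ^ ((n : ℝ) - 1) * (s / v) ^ (-((n : ℝ) + l + 2))) =
      s ^ (-l - 1) * v ^ ((n : ℝ) + l - 1) := by
  have hs_pow : s ^ (-l - 1) = s ^ 2 * s ^ ((n : ℝ) - 1) * s ^ (-((n : ℝ) + l + 2)) := by
    rw [← Real.rpow_natCast s 2, ← Real.rpow_add hs, ← Real.rpow_add hs]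
    congr 1
    push_cast
    ring
  have hv_pow : v ^ ((n : ℝ) + l - 1) * v ^ 3 * v ^ (-((n : ℝ) + l + 2)) = 1 := by
    rw [← Real.rpow_natCast v 3, ← Real.rpow_add hv, ← Real.rpow_add hv]
    convert Real.rpow_zero v using 2
    push_cast
    ring
  have hne : v ^ (-((n : ℝ) + l + 2)) ≠ 0 := (Real.rpow_pos_of_pos hv _).ne'
  rw [Real.div_rpow hs.le hv.le, hs_pow]
  field_simp
  linear_combination -hv_pow

/-- The change of variables `(μ, σ) ↦ ((x - μ) / σ, s / σ)` in the posterior expected loss. -/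
theorem postLoss_eq_mul_bayesObj (n : ℕ) (l : ℝ) (ρ f : ℝ → ℝ) (x : ℝ) {s : ℝ} (hs : 0 < s)
    (d : ℝ) :
    postLoss n l ρ f x s d =
      ENNReal.ofReal (s ^ (-l - 1)) * bayesObj n l ρ f (x / s) ((d - x) / s) := by
  unfold postLoss bayesObj
  rw [lintegral_Ioi_zero_eq_lintegral_div _ hs, ← lintegral_const_mul' _ _ ENNReal.ofReal_ne_top]
  refine setLIntegral_congr_fun measurableSet_Ioi fun v hv => ?_
  have hv : 0 < v := hv
  have hσ : 0 < s / v := div_pos hs hv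
  have hbound : x / (s / v) = v * (x / s) := by field_simp
  rw [lintegral_Ioi_zero_eq_lintegral_Iio_sub_mul _ x hσ, hbound,
    ← lintegral_const_mul' _ _ ENNReal.ofReal_ne_top,
    ← lintegral_const_mul' _ _ ENNReal.ofReal_ne_top]
  refine lintegral_congr fun u => ?_
  have hloss : (d - (x - s / v * u)) / (s / v) = u + (d - x) / s * v := by
    field_simp
    ring
  have hradius : ((x - (x - s / v * u)) ^ 2 + s ^ 2) / (s / v) ^ 2 = u ^ 2 + v ^ 2 := by
    field_simp
    ring
  rw [hloss, hradius, ← ENNReal.ofReal_mul hσ.le, ← ENNReal.ofReal_mul (by positivity),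
    ← ENNReal.ofReal_mul (by positivity)]
  congr 1
  linear_combination ρ (u + (d - x) / s * v) * f (u ^ 2 + v ^ 2) * jacobian_mul_rpow n l hs hv

/-- Lemma 2 (representation of the generalized Bayes estimator): the change of variables
`(μ,σ) ↦ ((x-μ)/σ, s/σ)` gives the identity of (possibly infinite) integrals
`postLoss = s^{-l-1} · bayesObj`, and consequently `d` minimizes the posterior expected
loss iff `h = (d-x)/s` minimizes the reduced objective with `y = x/s`; hence the
generalized Bayes estimator has the form `δ_{π_l}(x,s) = x + s·φ(x/s)`. -/
theorem stmt5
    (n : ℕ) (hn : 1 ≤ n) (l : ℝ)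
    (ρ f : ℝ → ℝ) (hρ_meas : Measurable ρ) (hf_meas : Measurable f)
    (hρ_nonneg : ∀ t, 0 ≤ ρ t) (hf_nonneg : ∀ t > (0 : ℝ), 0 ≤ f t)
    (x : ℝ) (s : ℝ) (hs : 0 < s) (d : ℝ) :
    postLoss n l ρ f x s d =
      ENNReal.ofReal (s ^ (-l - 1)) * bayesObj n l ρ f (x / s) ((d - x) / s) ∧
    ((∀ d' : ℝ, postLoss n l ρ f x s d ≤ postLoss n l ρ f x s d') ↔
      (∀ h' : ℝ, bayesObj n l ρ f (x / s) ((d - x) / s) ≤ bayesObj n l ρ f (x / s) h')) := by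
  have hpos : ENNReal.ofReal (s ^ (-l - 1)) ≠ 0 :=
    (ENNReal.ofReal_pos.2 (Real.rpow_pos_of_pos hs _)).ne'
  refine ⟨postLoss_eq_mul_bayesObj n l ρ f x hs d, ?_⟩
  simp only [postLoss_eq_mul_bayesObj n l ρ f x hs,
    ENNReal.mul_le_mul_iff_right hpos ENNReal.ofReal_ne_top]
  refine ⟨fun h h' => ?_, fun h d' => h _⟩
  have hshift : (x + s * h' - x) / s = h' := by
    field_simp
    ring
  simpa only [hshift] using h (x + s * h')
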